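/- arXiv:math/0403191 — 9 statements merged into one kernel-verified Lean document; each statement's English description precedes it below -/
import Mathlib

section
/- Let X be a finite set, let W be a weak order on X, and let W' be a binary relation on X. Then W' is a weak order containing W if and only if there exists an equivalence relation I' on X such that I_W ⊆ I', every I'-class is W-convex (i.e., for all x, y, z in X, if (x,y) ∈ I', (x,z) ∈ W and (z,y) ∈ W, then (x,z) ∈ I'), and W' = W ∪ I'. (This expresses that the weak orders containing W = (X_1,…,X_k) are exactly the weak orders whose indifference classes are unions of consecutive indifference classes of W.) -/
/-- A weak order on `X`: a transitive and strongly complete binary relation,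
represented as a set of pairs. -/
def IsWeakOrder {X : Type*} (W : Set (X × X)) : Prop :=
  (∀ x y z : X, (x, y) ∈ W → (y, z) ∈ W → (x, z) ∈ W) ∧
  (∀ x y : X, (x, y) ∈ W ∨ (y, x) ∈ W)

/-- The set of indifference classes of a relation `W`, i.e. the equivalence
classes of the indifference relation `I_W = W ∩ W⁻¹`. -/
def IndiffClasses {X : Type*} (W : Set (X × X)) : Set (Set X) :=
  {C | ∃ x : X, C = {y | (x, y) ∈ W ∧ (y, x) ∈ W}}

/-- A weak 2-order: a weak order with exactly two indifference classes. -/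
def IsWeak2Order {X : Type*} (W : Set (X × X)) : Prop :=
  IsWeakOrder W ∧ (IndiffClasses W).ncard = 2

/-- `JW W` is the set of all weak 2-orders containing `W`. -/
def JW {X : Type*} (W : Set (X × X)) : Set (Set (X × X)) :=
  {V | IsWeak2Order V ∧ W ⊆ V}

/-- `W'` is a weak order containing the weak order `W` iff
`W' = W ∪ I'` for some equivalence relation `I'` containing `I_W` whose
classes are `W`-convex. -/
theorem weak_order_containing_iff {X : Type*} [Fintype X]
    (W W' : Set (X × X)) (hW : IsWeakOrder W) :
    (IsWeakOrder W' ∧ W ⊆ W') ↔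
      ∃ I' : Set (X × X),
        (∀ x : X, (x, x) ∈ I') ∧
        (∀ x y : X, (x, y) ∈ I' → (y, x) ∈ I') ∧
        (∀ x y z : X, (x, y) ∈ I' → (y, z) ∈ I' → (x, z) ∈ I') ∧
        (∀ x y : X, (x, y) ∈ W → (y, x) ∈ W → (x, y) ∈ I') ∧
        (∀ x y z : X, (x, y) ∈ I' → (x, z) ∈ W → (z, y) ∈ W → (x, z) ∈ I') ∧
        W' = W ∪ I' := by
  obtain ⟨hWt, hWc⟩ := hW
  constructor
  · rintro ⟨⟨ht, _⟩, hsub⟩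
    refine ⟨{p | p ∈ W' ∧ (p.2, p.1) ∈ W'}, fun x => ?_, fun x y h => ⟨h.2, h.1⟩,
      fun x y z h h' => ⟨ht _ _ _ h.1 h'.1, ht _ _ _ h'.2 h.2⟩,
      fun x y h h' => ⟨hsub h, hsub h'⟩,
      fun x y z h hxz hzy => ⟨hsub hxz, ht _ _ _ (hsub hzy) h.2⟩, ?_⟩
    · have h : (x, x) ∈ W := (hWc x x).elim id id
      exact ⟨hsub h, hsub h⟩
    · ext ⟨x, y⟩
      refine ⟨fun h => ?_, fun h => h.elim (fun h => hsub h) And.left⟩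
      exact (hWc x y).elim Or.inl fun hyx => Or.inr ⟨h, hsub hyx⟩
  · rintro ⟨I', _, hsymm, htrans, _, hconv, rfl⟩
    refine ⟨⟨?_, fun x y => (hWc x y).imp Or.inl Or.inl⟩, Set.subset_union_left⟩
    rintro x y z (hxy | hxy) (hyz | hyz)
    · exact Or.inl (hWt _ _ _ hxy hyz)
    · exact (hWc x z).imp_right fun hzx => hsymm _ _ (hconv _ _ _ (hsymm _ _ hyz) hzx hxy)
    · exact (hWc x z).imp_right fun hzx =>
        htrans _ _ _ hxy (hconv _ _ _ (hsymm _ _ hxy) hyz hzx)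
    · exact Or.inr (htrans _ _ _ hxy hyz)
end

section
/- Let W ⊊ W' be weak orders on a finite set X. Then W' covers W (i.e., no weak order lies strictly between W and W') if and only if the number of indifference classes of W' is one less than the number of indifference classes of W; equivalently, W' is obtained from W = (X_1,…,X_k) by merging two adjacent indifference classes X_i and X_{i+1}. -/
section WeakOrder

variable {X : Type*} {W V : Set (X × X)} {a b x y : X}

/-- The indifference class of a point. -/
def indiffClass (W : Set (X × X)) (x : X) : Set X :=
  {y | (x, y) ∈ W ∧ (y, x) ∈ W}

/-- The set of points that are `V`-indifferent to some point of `C`. -/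
def indiffSaturation (V : Set (X × X)) (C : Set X) : Set X :=
  {y | ∃ x ∈ C, (x, y) ∈ V ∧ (y, x) ∈ V}

theorem indiffClass_mem (W : Set (X × X)) (x : X) : indiffClass W x ∈ IndiffClasses W :=
  ⟨x, rfl⟩

namespace IsWeakOrder

theorem refl_mem (hW : IsWeakOrder W) (x : X) : (x, x) ∈ W :=
  (hW.2 x x).elim id id

theorem indiffClass_eq_iff (hW : IsWeakOrder W) :
    indiffClass W x = indiffClass W y ↔ (x, y) ∈ W ∧ (y, x) ∈ W := by
  constructor
  · intro h
    have hy : y ∈ indiffClass W y := ⟨hW.refl_mem y, hW.refl_mem y⟩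
    rwa [← h] at hy
  · rintro ⟨hxy, hyx⟩
    ext z
    exact ⟨fun h => ⟨hW.1 _ _ _ hyx h.1, hW.1 _ _ _ h.2 hxy⟩,
      fun h => ⟨hW.1 _ _ _ hxy h.1, hW.1 _ _ _ h.2 hyx⟩⟩

theorem indiffSaturation_indiffClass (hW : IsWeakOrder W) (hV : IsWeakOrder V) (hWV : W ⊆ V)
    (x : X) : indiffSaturation V (indiffClass W x) = indiffClass V x := by
  ext z
  constructor
  · rintro ⟨y, hy, hyz, hzy⟩
    exact ⟨hV.1 _ _ _ (hWV hy.1) hyz, hV.1 _ _ _ hzy (hWV hy.2)⟩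
  · intro hz
    exact ⟨x, ⟨hW.refl_mem x, hW.refl_mem x⟩, hz⟩

/-- If `a` and `b` are indifferent for the larger order only, the class of `b` is not needed to
reach every class of the larger order. -/
theorem indiffClasses_eq_image (hW : IsWeakOrder W) (hV : IsWeakOrder V) (hWV : W ⊆ V)
    (hab : (a, b) ∈ V) (hba : (b, a) ∈ V) (hba' : (b, a) ∉ W) :
    IndiffClasses V = indiffSaturation V '' (IndiffClasses W \ {indiffClass W b}) := by
  ext C
  constructor
  · rintro ⟨x, rfl⟩
    by_cases hx : indiffClass W x = indiffClass W b
    · refine ⟨indiffClass W a, ⟨indiffClass_mem W a, fun h => ?_⟩, ?_⟩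
      · exact hba' (hW.indiffClass_eq_iff.1 h).2
      · have hxb := hW.indiffClass_eq_iff.1 hx
        rw [hW.indiffSaturation_indiffClass hV hWV]
        exact hV.indiffClass_eq_iff.2
          ⟨hV.1 _ _ _ hab (hWV hxb.2), hV.1 _ _ _ (hWV hxb.1) hba⟩
    · exact ⟨indiffClass W x, ⟨indiffClass_mem W x, hx⟩,
        hW.indiffSaturation_indiffClass hV hWV x⟩
  · rintro ⟨_, ⟨⟨x, rfl⟩, -⟩, rfl⟩
    exact ⟨x, hW.indiffSaturation_indiffClass hV hWV x⟩

theorem ncard_indiffClasses_lt [Finite X] (hW : IsWeakOrder W) (hV : IsWeakOrder V)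
    (hWV : W ⊂ V) : (IndiffClasses V).ncard < (IndiffClasses W).ncard := by
  obtain ⟨hsub, ⟨b, a⟩, hba, hba'⟩ := Set.ssubset_iff_exists.1 hWV
  rw [hW.indiffClasses_eq_image hV hsub (hsub ((hW.2 a b).resolve_right hba')) hba hba']
  exact (Set.ncard_image_le (Set.toFinite _)).trans_lt
    (Set.ncard_sdiff_singleton_lt_of_mem (indiffClass_mem W b))

/-- Adding the pairs from the class of `b` to the class of `a` merges two adjacent classes. -/
theorem union_prod (hW : IsWeakOrder W) (hba : (b, a) ∉ W)
    (hadj : ∀ c, (c, a) ∈ W ∨ (b, c) ∈ W) :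
    IsWeakOrder (W ∪ indiffClass W b ×ˢ indiffClass W a) := by
  have htr := hW.1
  refine ⟨?_, fun x y => (hW.2 x y).imp Or.inl Or.inl⟩
  rintro x y z (hxy | ⟨hx, hy⟩) (hyz | ⟨hy', hz⟩)
  · exact Or.inl (htr _ _ _ hxy hyz)
  · rcases hadj x with h | h
    · exact Or.inl (htr _ _ _ h hz.1)
    · exact Or.inr ⟨⟨h, htr _ _ _ hxy hy'.2⟩, hz⟩
  · rcases hadj z with h | h
    · exact Or.inr ⟨hx, htr _ _ _ hy.1 hyz, h⟩
    · exact Or.inl (htr _ _ _ hx.2 h)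
  · exact absurd (htr _ _ _ hy'.1 hy.2) hba

theorem ncard_indiffClasses_union_prod [Finite X] (hW : IsWeakOrder W) (hba : (b, a) ∉ W)
    (hadj : ∀ c, (c, a) ∈ W ∨ (b, c) ∈ W) :
    (IndiffClasses (W ∪ indiffClass W b ×ˢ indiffClass W a)).ncard + 1 =
      (IndiffClasses W).ncard := by
  have hV := hW.union_prod hba hadj
  have hsub : W ⊆ W ∪ indiffClass W b ×ˢ indiffClass W a := Set.subset_union_left
  rw [hW.indiffClasses_eq_image hV hsub (hsub ((hW.2 a b).resolve_right hba))
    (Or.inr ⟨⟨hW.refl_mem b, hW.refl_mem b⟩, ⟨hW.refl_mem a, hW.refl_mem a⟩⟩) hba,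
    Set.InjOn.ncard_image, Set.ncard_sdiff_singleton_add_one (indiffClass_mem W b)]
  rintro _ ⟨⟨x, rfl⟩, hx⟩ _ ⟨⟨y, rfl⟩, hy⟩ hxy
  change indiffSaturation _ (indiffClass W x) = indiffSaturation _ (indiffClass W y) at hxy
  rw [hW.indiffSaturation_indiffClass hV hsub, hW.indiffSaturation_indiffClass hV hsub,
    hV.indiffClass_eq_iff] at hxy
  have key : ∀ z, indiffClass W z ≠ indiffClass W b → z ∉ indiffClass W b :=
    fun z hz h => hz (hW.indiffClass_eq_iff.2 h.symm)
  exact hW.indiffClass_eq_iff.2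
    ⟨hxy.1.resolve_right fun h => key x hx h.1, hxy.2.resolve_right fun h => key y hy h.1⟩

theorem exists_adjacent [Finite X] (hW : IsWeakOrder W) (hV : IsWeakOrder V) (hWV : W ⊂ V) :
    ∃ a b, (b, a) ∈ V ∧ (b, a) ∉ W ∧ ∀ c, (c, a) ∈ W ∨ (b, c) ∈ W := by
  obtain ⟨hsub, hne⟩ := Set.ssubset_iff_exists.1 hWV
  obtain ⟨⟨b, a⟩, ⟨hba, hba'⟩, hmin⟩ := Set.exists_min_image (V \ W)
    (fun p => {c | (p.2, c) ∈ W ∧ (c, p.1) ∈ W}.ncard) (Set.toFinite _) hne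
  refine ⟨a, b, hba, hba', fun c => ?_⟩
  by_contra! hc
  have hac := (hW.2 a c).resolve_right hc.1
  have hcb := (hW.2 c b).resolve_right hc.2
  refine (hmin (c, a) ⟨hV.1 _ _ _ (hsub hcb) hba, hc.1⟩).not_gt
    (Set.ncard_lt_ncard (Set.ssubset_iff_exists.2 ⟨?_, b, ?_, ?_⟩) (Set.toFinite _))
  · exact fun d hd => ⟨hd.1, hW.1 _ _ _ hd.2 hcb⟩
  · exact ⟨hW.1 _ _ _ hac hcb, hW.refl_mem b⟩
  · exact fun h => hc.2 h.2

theorem exists_ncard_indiffClasses_add_one [Finite X] (hW : IsWeakOrder W)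
    (hV : IsWeakOrder V) (hWV : W ⊂ V) :
    ∃ U, IsWeakOrder U ∧ W ⊂ U ∧ U ⊆ V ∧
      (IndiffClasses U).ncard + 1 = (IndiffClasses W).ncard := by
  obtain ⟨a, b, hba, hba', hadj⟩ := hW.exists_adjacent hV hWV
  refine ⟨_, hW.union_prod hba' hadj,
    Set.ssubset_iff_exists.2 ⟨Set.subset_union_left, (b, a), Or.inr ?_, hba'⟩,
    Set.union_subset hWV.subset ?_, hW.ncard_indiffClasses_union_prod hba' hadj⟩
  · exact ⟨⟨hW.refl_mem b, hW.refl_mem b⟩, ⟨hW.refl_mem a, hW.refl_mem a⟩⟩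
  · rintro ⟨x, y⟩ ⟨hx, hy⟩
    exact hV.1 _ _ _ (hWV.subset hx.2) (hV.1 _ _ _ hba (hWV.subset hy.1))

end IsWeakOrder

end WeakOrder

/-- for weak orders `W ⊊ W'`, `W'` covers `W` iff the number of
indifference classes of `W'` is one less than that of `W`. -/
theorem covers_iff_one_less_class {X : Type*} [Fintype X]
    (W W' : Set (X × X)) (hW : IsWeakOrder W) (hW' : IsWeakOrder W')
    (hss : W ⊂ W') :
    (¬∃ W'' : Set (X × X), IsWeakOrder W'' ∧ W ⊂ W'' ∧ W'' ⊂ W') ↔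
      (IndiffClasses W').ncard + 1 = (IndiffClasses W).ncard := by
  constructor
  · intro h
    obtain ⟨U, hU, hWU, hUW', hcard⟩ := hW.exists_ncard_indiffClasses_add_one hW' hss
    obtain rfl | hlt := hUW'.eq_or_ssubset
    · exact hcard
    · exact absurd ⟨U, hU, hWU, hlt⟩ h
  · rintro hcard ⟨U, hU, hWU, hUW'⟩
    have h₁ := hW.ncard_indiffClasses_lt hU hWU
    have h₂ := hU.ncard_indiffClasses_lt hW' hUW'
    omega
end

section
/- Every weak order W on a finite set X is the intersection of all weak 2-orders containing it: for all x, y ∈ X, (x,y) ∈ W if and only if (x,y) ∈ V for every weak 2-order V on X with W ⊆ V. (For the trivial weak order X × X this intersection is over the empty family and equals X × X.) -/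
/-- The relation placing `S` above its complement, with indifference inside each of the two. -/
def cutOrder {X : Type*} (S : Set X) : Set (X × X) :=
  {p | p.2 ∈ S → p.1 ∈ S}

theorem isWeakOrder_cutOrder {X : Type*} (S : Set X) : IsWeakOrder (cutOrder S) :=
  ⟨fun _ _ _ hab hbc hc => hab (hbc hc), fun a b => by
    change (b ∈ S → a ∈ S) ∨ (a ∈ S → b ∈ S)
    tauto⟩

theorem indiffClasses_cutOrder {X : Type*} {S : Set X} {x y : X} (hx : x ∉ S) (hy : y ∈ S) :
    IndiffClasses (cutOrder S) = {S, Sᶜ} := by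
  have class_of_mem {a : X} (ha : a ∈ S) :
      {b | (a, b) ∈ cutOrder S ∧ (b, a) ∈ cutOrder S} = S := by
    ext b
    simp [cutOrder, ha]
  have class_of_notMem {a : X} (ha : a ∉ S) :
      {b | (a, b) ∈ cutOrder S ∧ (b, a) ∈ cutOrder S} = Sᶜ := by
    ext b
    simp [cutOrder, ha]
  ext C
  constructor
  · rintro ⟨a, rfl⟩
    by_cases ha : a ∈ S
    · exact Or.inl (class_of_mem ha)
    · exact Or.inr (class_of_notMem ha)
  · rintro (rfl | rfl)
    · exact ⟨y, (class_of_mem hy).symm⟩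
    · exact ⟨x, (class_of_notMem hx).symm⟩

theorem isWeak2Order_cutOrder {X : Type*} {S : Set X} {x y : X} (hx : x ∉ S) (hy : y ∈ S) :
    IsWeak2Order (cutOrder S) := by
  refine ⟨isWeakOrder_cutOrder S, ?_⟩
  rw [indiffClasses_cutOrder hx hy]
  refine Set.ncard_pair fun h => ?_
  have hy' : y ∈ Sᶜ := h ▸ hy
  exact hy' hy

/-- every weak order is the intersection of all weak 2-orders
containing it. -/
theorem weak_order_eq_inter_weak2orders {X : Type*} [Fintype X]
    (W : Set (X × X)) (hW : IsWeakOrder W) :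
    ∀ x y : X, (x, y) ∈ W ↔
      ∀ V : Set (X × X), IsWeak2Order V → W ⊆ V → (x, y) ∈ V := by
  obtain ⟨htrans, htotal⟩ := hW
  intro x y
  refine ⟨fun h V _ hWV => hWV h, fun h => ?_⟩
  by_contra hxy
  have hyy : (y, y) ∈ W := (htotal y y).elim id id
  exact hxy (h (cutOrder {a | (a, y) ∈ W}) (isWeak2Order_cutOrder hxy hyy)
    (fun p hp hq => htrans p.1 p.2 y hp hq) hyy)
end

section
/- Let W be a weak order on a finite set X and let J be a set of weak 2-orders on X such that W = ⋂_{V ∈ J} V (where the empty intersection is X × X). Then J = J_W, the set of all weak 2-orders on X containing W. Hence every weak order admits a unique representation as an intersection of weak 2-orders. -/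
theorem IsWeakOrder.exists_forall_mem_of_nonempty {X : Type*} {W : Set (X × X)}
    (hW : IsWeakOrder W) {s : Set X} (hs : s.Finite) (hne : s.Nonempty) :
    ∃ u ∈ s, ∀ x ∈ s, (x, u) ∈ W := by
  induction s, hs using Set.Finite.induction_on with
  | empty => exact absurd hne Set.not_nonempty_empty
  | @insert a s _ _ ih =>
    have haa : (a, a) ∈ W := or_self_iff.mp (hW.2 a a)
    rcases s.eq_empty_or_nonempty with rfl | h
    · exact ⟨a, by simp, by simpa using haa⟩
    · obtain ⟨u, hu, hmin⟩ := ih h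
      rcases hW.2 a u with hau | hua
      · refine ⟨u, Set.mem_insert_of_mem _ hu, ?_⟩
        rintro x (rfl | hx)
        exacts [hau, hmin x hx]
      · refine ⟨a, Set.mem_insert _ _, ?_⟩
        rintro x (rfl | hx)
        exacts [haa, hW.1 x u a (hmin x hx) hua]

theorem IsWeakOrder.swap {X : Type*} {W : Set (X × X)} (hW : IsWeakOrder W) :
    IsWeakOrder (Prod.swap ⁻¹' W) :=
  ⟨fun x y z hxy hyz => hW.1 z y x hyz hxy, fun x y => hW.2 y x⟩

theorem IsWeakOrder.indiffClass_eq_iff_s3 {X : Type*} {V : Set (X × X)} (hV : IsWeakOrder V)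
    (x y : X) :
    ({z | (x, z) ∈ V ∧ (z, x) ∈ V} : Set X) = {z | (y, z) ∈ V ∧ (z, y) ∈ V} ↔
      (x, y) ∈ V ∧ (y, x) ∈ V := by
  constructor
  · intro h
    have hy : y ∈ ({z | (y, z) ∈ V ∧ (z, y) ∈ V} : Set X) :=
      ⟨or_self_iff.mp (hV.2 y y), or_self_iff.mp (hV.2 y y)⟩
    rwa [← h] at hy
  · rintro ⟨hxy, hyx⟩
    ext z
    exact ⟨fun h => ⟨hV.1 y x z hyx h.1, hV.1 z x y h.2 hxy⟩,
      fun h => ⟨hV.1 x y z hxy h.1, hV.1 z y x h.2 hyx⟩⟩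

theorem IsWeak2Order.exists_notMem {X : Type*} {V : Set (X × X)} (hV : IsWeak2Order V) :
    ∃ a b : X, (a, b) ∉ V := by
  obtain ⟨C, D, hne, h⟩ := Set.ncard_eq_two.mp hV.2
  obtain ⟨a, rfl⟩ : C ∈ IndiffClasses V := by simp [h]
  obtain ⟨b, rfl⟩ : D ∈ IndiffClasses V := by simp [h]
  by_contra! hall
  exact hne ((hV.1.indiffClass_eq_iff_s3 a b).mpr ⟨hall a b, hall b a⟩)

theorem IsWeak2Order.indifferent_or_indifferent {X : Type*} {V : Set (X × X)}
    (hV : IsWeak2Order V) {a b : X} (hab : (a, b) ∉ V) (x : X) :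
    ((x, a) ∈ V ∧ (a, x) ∈ V) ∨ ((x, b) ∈ V ∧ (b, x) ∈ V) := by
  obtain ⟨C, D, -, h⟩ := Set.ncard_eq_two.mp hV.2
  have key (y : X) : ({z | (y, z) ∈ V ∧ (z, y) ∈ V} : Set X) = C ∨
      ({z | (y, z) ∈ V ∧ (z, y) ∈ V} : Set X) = D := by
    have hy : ({z | (y, z) ∈ V ∧ (z, y) ∈ V} : Set X) ∈ IndiffClasses V := ⟨y, rfl⟩
    rwa [h] at hy
  have hne := fun e => hab ((hV.1.indiffClass_eq_iff_s3 a b).mp e).1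
  rw [← hV.1.indiffClass_eq_iff_s3 x a, ← hV.1.indiffClass_eq_iff_s3 x b]
  have hx := key x
  have ha := key a
  have hb := key b
  grind

/-- A weak 2-order is determined by a strict pair together with its upper class. -/
theorem IsWeak2Order.mem_iff {X : Type*} {V : Set (X × X)} (hV : IsWeak2Order V)
    {l u : X} (hlu : (l, u) ∉ V) (x y : X) :
    (x, y) ∈ V ↔ (x, u) ∈ V ∨ (l, y) ∈ V := by
  have hx := hV.indifferent_or_indifferent hlu x
  have hy := hV.indifferent_or_indifferent hlu y
  have ht := hV.1.1
  have hul := (hV.1.2 l u).resolve_left hlu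
  constructor
  · intro hxy
    rcases hx with hx | hx
    · exact Or.inr (ht l x y hx.2 hxy)
    · exact Or.inl hx.1
  · rintro (hxu | hly)
    · rcases hy with hy | hy
      · exact ht x u y hxu (ht u l y hul hy.2)
      · exact ht x u y hxu hy.2
    · rcases hx with hx | hx
      · exact ht x l y hx.1 hly
      · exact ht x u y hx.1 (ht u l y hul hly)

/-- if a weak order `W` is the intersection of a set `J` of weak
2-orders (with empty intersection `X × X`, i.e. `univ`), then `J = J_W`.
Hence the representation as an intersection of weak 2-orders is unique. -/
theorem unique_intersection_representation {X : Type*} [Fintype X]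
    (W : Set (X × X)) (hW : IsWeakOrder W)
    (J : Set (Set (X × X))) (hJ : ∀ V ∈ J, IsWeak2Order V)
    (hint : W = ⋂₀ J) :
    J = JW W := by
  refine Set.Subset.antisymm
    (fun V hV => ⟨hJ V hV, hint.trans_subset (Set.sInter_subset_of_mem hV)⟩) ?_
  rintro V ⟨hV, hWV⟩
  obtain ⟨a, b, hab⟩ := hV.exists_notMem
  have hrefl (x : X) : (x, x) ∈ V := or_self_iff.mp (hV.1.2 x x)
  obtain ⟨u, hu, hmin⟩ :=
    hW.exists_forall_mem_of_nonempty (Set.toFinite {x | (x, b) ∈ V}) ⟨b, hrefl b⟩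
  obtain ⟨l, hl, hmax⟩ :=
    hW.swap.exists_forall_mem_of_nonempty (Set.toFinite {x | (a, x) ∈ V}) ⟨a, hrefl a⟩
  have hlu : (l, u) ∉ V := fun h => hab (hV.1.1 a u b (hV.1.1 a l u hl h) hu)
  obtain ⟨V', hV'J, hlu'⟩ : ∃ V' ∈ J, (l, u) ∉ V' := by
    by_contra! h
    exact hlu (hWV (hint ▸ Set.mem_sInter.mpr h))
  have hV' := hJ V' hV'J
  have hWV' : W ⊆ V' := hint.trans_subset (Set.sInter_subset_of_mem hV'J)
  have hupper (x : X) (hx : (x, u) ∈ V) : (x, u) ∈ V' :=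
    hWV' (hmin x (hV.1.1 x u b hx hu))
  have hlower (y : X) (hy : (l, y) ∈ V) : (l, y) ∈ V' :=
    hWV' (hmax y (hV.1.1 a l y hl hy))
  have hupper' (x : X) (hx : (x, u) ∈ V') : (x, u) ∈ V := by
    rcases hV.indifferent_or_indifferent hlu x with h | h
    · exact absurd (hV'.1.1 l x u (hlower x h.2) hx) hlu'
    · exact h.1
  have hlower' (y : X) (hy : (l, y) ∈ V') : (l, y) ∈ V := by
    rcases hV.indifferent_or_indifferent hlu y with h | h
    · exact h.2
    · exact absurd (hV'.1.1 l y u hy (hupper y h.1)) hlu'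
  have hVV' : V' = V := by
    ext ⟨x, y⟩
    rw [hV.mem_iff hlu, hV'.mem_iff hlu']
    exact or_congr ⟨hupper' x, hupper x⟩ ⟨hlower' y, hlower y⟩
  exact hVV' ▸ hV'J
end

section
/- The map W ↦ J_W is a dual isomorphism of posets from the set of all weak orders on a finite set X (ordered by inclusion) onto its image 𝒥 = {J_W : W a weak order on X} (ordered by inclusion): for all weak orders W and W' on X, W ⊆ W' if and only if J_{W'} ⊆ J_W; in particular the map W ↦ J_W is injective. -/
/-- The weak order whose pairs `(a, b)` are those for which `a ∈ U` implies `b ∈ U`. -/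
def upperSetOrder {X : Type*} (U : Set X) : Set (X × X) :=
  {p | p.1 ∈ U → p.2 ∈ U}

theorem isWeakOrder_upperSetOrder {X : Type*} (U : Set X) : IsWeakOrder (upperSetOrder U) := by
  refine ⟨fun _ _ _ hxy hyz hx => hyz (hxy hx), fun x y => ?_⟩
  by_cases hy : y ∈ U
  · exact Or.inl fun _ => hy
  · exact Or.inr fun h => absurd h hy

theorem indiffClasses_upperSetOrder {X : Type*} {U : Set X} {x y : X} (hx : x ∈ U) (hy : y ∉ U) :
    IndiffClasses (upperSetOrder U) = {U, Uᶜ} := by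
  have class_mem {a : X} (ha : a ∈ U) :
      {b | (a, b) ∈ upperSetOrder U ∧ (b, a) ∈ upperSetOrder U} = U := by
    ext b
    simp [upperSetOrder, ha]
  have class_notMem {a : X} (ha : a ∉ U) :
      {b | (a, b) ∈ upperSetOrder U ∧ (b, a) ∈ upperSetOrder U} = Uᶜ := by
    ext b
    simp [upperSetOrder, ha]
  apply Set.Subset.antisymm
  · rintro _ ⟨a, rfl⟩
    by_cases ha : a ∈ U
    · exact Or.inl (class_mem ha)
    · exact Or.inr (class_notMem ha)
  · rintro _ (rfl | rfl)
    · exact ⟨x, (class_mem hx).symm⟩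
    · exact ⟨y, (class_notMem hy).symm⟩

theorem isWeak2Order_upperSetOrder {X : Type*} {U : Set X} {x y : X} (hx : x ∈ U) (hy : y ∉ U) :
    IsWeak2Order (upperSetOrder U) := by
  refine ⟨isWeakOrder_upperSetOrder U, ?_⟩
  rw [indiffClasses_upperSetOrder hx hy]
  exact Set.ncard_pair fun h => (h ▸ hx : x ∈ Uᶜ) hx

theorem JW_antitone {X : Type*} {W W' : Set (X × X)} (h : W ⊆ W') : JW W' ⊆ JW W :=
  fun _ hV => ⟨hV.1, h.trans hV.2⟩

/-- A pair outside a weak order `W` is separated from `W` by a weak 2-order. -/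
theorem exists_mem_JW_notMem {X : Type*} {W : Set (X × X)} (hW : IsWeakOrder W) {x y : X}
    (hxy : (x, y) ∉ W) : ∃ V ∈ JW W, (x, y) ∉ V := by
  have hx : x ∈ {z | (x, z) ∈ W} := (hW.2 x x).elim id id
  refine ⟨upperSetOrder {z | (x, z) ∈ W}, ⟨isWeak2Order_upperSetOrder hx hxy, ?_⟩,
    fun h => hxy (h hx)⟩
  rintro ⟨a, b⟩ hab ha
  exact hW.1 x a b ha hab

theorem subset_of_JW_subset {X : Type*} {W W' : Set (X × X)} (hW' : IsWeakOrder W')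
    (h : JW W' ⊆ JW W) : W ⊆ W' := by
  rintro ⟨x, y⟩ hxy
  by_contra hn
  obtain ⟨V, hV, hnV⟩ := exists_mem_JW_notMem hW' hn
  exact hnV ((h hV).2 hxy)

/-- `W ↦ J_W` is a dual isomorphism of the poset of weak orders
onto its image: `W ⊆ W' ↔ J_{W'} ⊆ J_W`; in particular it is injective. -/
theorem JW_dual_isomorphism {X : Type*} [Fintype X] :
    (∀ W W' : Set (X × X), IsWeakOrder W → IsWeakOrder W' →
      (W ⊆ W' ↔ JW W' ⊆ JW W)) ∧
    (∀ W W' : Set (X × X), IsWeakOrder W → IsWeakOrder W' →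
      JW W = JW W' → W = W') := by
  exact ⟨fun _ _ _ hW' => ⟨JW_antitone, subset_of_JW_subset hW'⟩,
    fun _ _ hW hW' h => Set.Subset.antisymm (subset_of_JW_subset hW' h.symm.subset)
      (subset_of_JW_subset hW h.subset)⟩
end

section
/- Let W be a weak order on a finite set X and let J' be any subset of J_W (the set of weak 2-orders containing W). Then ⋂_{V ∈ J'} V (equal to X × X when J' is empty) is a weak order on X. Consequently, the family 𝒥 = {J_W : W a weak order on X} is a combinatorial simplicial complex: J ∈ 𝒥 and J' ⊆ J imply J' ∈ 𝒥. -/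
theorem IsWeakOrder.sInter {X : Type*} {W : Set (X × X)} (hW : IsWeakOrder W)
    {S : Set (Set (X × X))} (hS : ∀ V ∈ S, IsWeakOrder V ∧ W ⊆ V) : IsWeakOrder (⋂₀ S) := by
  refine ⟨fun x y z hxy hyz V hV => (hS V hV).1.1 x y z (hxy V hV) (hyz V hV), fun x y => ?_⟩
  exact (hW.2 x y).imp (fun h V hV => (hS V hV).2 h) (fun h V hV => (hS V hV).2 h)

theorem IsWeakOrder.exists_least {X : Type*} [Finite X] {W : Set (X × X)} (hW : IsWeakOrder W)
    {S : Set X} (hS : S.Nonempty) : ∃ a ∈ S, ∀ u ∈ S, (u, a) ∈ W := by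
  let r : X → X → Prop := fun x y => (x, y) ∉ W
  have : IsTrans X r := ⟨fun x y z hxy hyz hxz =>
    hyz (hW.1 y x z ((hW.2 x y).resolve_left hxy) hxz)⟩
  have : Std.Irrefl r := ⟨fun x hx => hx ((hW.2 x x).elim id id)⟩
  obtain ⟨a, ha, hmin⟩ := (Finite.wellFounded_of_trans_of_irrefl r).has_min S hS
  exact ⟨a, ha, fun u hu => not_not.1 (hmin u hu)⟩

/-- A weak 2-order is determined by its upper indifference class `U`. -/
theorem IsWeak2Order.exists_upper {X : Type*} {V : Set (X × X)} (hV : IsWeak2Order V) :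
    ∃ U : Set X, U.Nonempty ∧ Uᶜ.Nonempty ∧ ∀ x y, (x, y) ∈ V ↔ x ∈ U ∨ y ∉ U := by
  obtain ⟨⟨htrans, htotal⟩, hcard⟩ := hV
  obtain ⟨A, B, hAB, hclasses⟩ := Set.ncard_eq_two.1 hcard
  obtain ⟨a, ha⟩ : A ∈ IndiffClasses V := by simp [hclasses]
  obtain ⟨b, hb⟩ : B ∈ IndiffClasses V := by simp [hclasses]
  have hrefl : ∀ x, (x, x) ∈ V := fun x => (htotal x x).elim id id
  have hmem : ∀ x, x ∈ A ∨ x ∈ B := by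
    intro x
    have hx : {y | (x, y) ∈ V ∧ (y, x) ∈ V} ∈ IndiffClasses V := ⟨x, rfl⟩
    rw [hclasses] at hx
    have hxx : x ∈ {y | (x, y) ∈ V ∧ (y, x) ∈ V} := ⟨hrefl x, hrefl x⟩
    rcases hx with h | h
    · exact Or.inl (h ▸ hxx)
    · exact Or.inr (Set.mem_singleton_iff.1 h ▸ hxx)
  subst ha hb
  have hab : ¬ ((a, b) ∈ V ∧ (b, a) ∈ V) := by
    rintro ⟨h₁, h₂⟩
    apply hAB
    ext y
    exact ⟨fun h => ⟨htrans _ _ _ h₂ h.1, htrans _ _ _ h.2 h₁⟩,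
      fun h => ⟨htrans _ _ _ h₁ h.1, htrans _ _ _ h.2 h₂⟩⟩
  have key : ∀ c d, (d, c) ∉ V →
      (∀ x, ((c, x) ∈ V ∧ (x, c) ∈ V) ∨ ((d, x) ∈ V ∧ (x, d) ∈ V)) →
      ∃ U : Set X, U.Nonempty ∧ Uᶜ.Nonempty ∧ ∀ x y, (x, y) ∈ V ↔ x ∈ U ∨ y ∉ U := by
    intro c d hdc hcd
    refine ⟨{x | (x, c) ∈ V}, ⟨c, hrefl c⟩, ⟨d, hdc⟩, fun x y => ?_⟩
    have hx := hcd x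
    have hy := hcd y
    have hcd' := htotal c d
    simp only [Set.mem_ofPred_eq]
    grind
  by_cases h : (b, a) ∈ V
  · exact key b a (fun h' => hab ⟨h', h⟩) fun x => (hmem x).symm
  · exact key a b h hmem

theorem IsWeak2Order.mem_of_sInter_subset {X : Type*} [Finite X] {S : Set (Set (X × X))}
    (hS : ∀ V ∈ S, IsWeak2Order V) (hW : IsWeakOrder (⋂₀ S)) {V : Set (X × X)}
    (hV : IsWeak2Order V) (hSV : ⋂₀ S ⊆ V) : V ∈ S := by
  obtain ⟨U, hU, hU', hVU⟩ := hV.exists_upper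
  obtain ⟨a, ha, hmin⟩ := hW.exists_least hU
  obtain ⟨b, hb, hmax⟩ := hW.swap.exists_least hU'
  have hba : (b, a) ∉ ⋂₀ S := fun h => ((hVU b a).1 (hSV h)).elim hb (fun h => h ha)
  simp only [Set.mem_sInter, not_forall] at hba
  obtain ⟨V₁, hV₁, hba⟩ := hba
  obtain ⟨U₁, -, -, hVU₁⟩ := (hS V₁ hV₁).exists_upper
  have hUU : U = U₁ := by
    ext x
    by_cases hx : x ∈ U
    · have := hmin x hx V₁ hV₁
      grind
    · have : (b, x) ∈ V₁ := hmax x hx V₁ hV₁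
      grind
  have : V = V₁ := by
    ext ⟨x, y⟩
    rw [hVU, hVU₁, hUU]
  exact this ▸ hV₁

/-- for a weak order `W` and any `J' ⊆ J_W`, the intersection
`⋂₀ J'` (equal to `univ` when `J'` is empty) is a weak order; consequently the
family `𝒥 = {J_W : W a weak order}` is a combinatorial simplicial complex. -/
theorem JW_simplicial_complex {X : Type*} [Fintype X] :
    (∀ W : Set (X × X), IsWeakOrder W → ∀ J' ⊆ JW W, IsWeakOrder (⋂₀ J')) ∧
    (∀ J ∈ {J : Set (Set (X × X)) | ∃ W, IsWeakOrder W ∧ J = JW W},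
      ∀ J' ⊆ J, J' ∈ {J : Set (Set (X × X)) | ∃ W, IsWeakOrder W ∧ J = JW W}) := by
  have hinter : ∀ W : Set (X × X), IsWeakOrder W → ∀ J' ⊆ JW W, IsWeakOrder (⋂₀ J') :=
    fun W hW J' hJ' => hW.sInter fun V hV => ⟨(hJ' hV).1.1, (hJ' hV).2⟩
  refine ⟨hinter, ?_⟩
  rintro _ ⟨W, hW, rfl⟩ J' hJ'
  have hI := hinter W hW J' hJ'
  refine ⟨⋂₀ J', hI, Set.Subset.antisymm ?_ ?_⟩
  · exact fun V hV => ⟨(hJ' hV).1, Set.sInter_subset_of_mem hV⟩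
  · exact fun V hV => IsWeak2Order.mem_of_sInter_subset (fun V hV => (hJ' hV).1) hI hV.1 hV.2
end

section
/- Let X be a finite set with n = |X| ≥ 2 and let L be a linear order on X (an antisymmetric weak order). Then the set {W : W a weak order on X with L ⊆ W}, partially ordered by inclusion, is order-isomorphic to the lattice of all subsets of an (n−1)-element set ordered by inclusion (i.e., this interval of the Hasse diagram of weak orders above L is a Boolean lattice of rank n−1, a combinatorial (n−1)-cube). -/
theorem IsWeakOrder.exists_equiv_fin {X : Type*} [Fintype X] {L : Set (X × X)}
    (hL : IsWeakOrder L) (hanti : ∀ x y : X, (x, y) ∈ L → (y, x) ∈ L → x = y) :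
    ∃ e : X ≃ Fin (Fintype.card X), ∀ x y, (x, y) ∈ L ↔ e x ≤ e y := by
  classical
  let _ : LinearOrder X :=
    { le := fun x y => (x, y) ∈ L
      le_refl := fun x => (hL.2 x x).elim id id
      le_trans := hL.1
      le_antisymm := hanti
      le_total := hL.2
      toDecidableLE := Classical.decRel _ }
  let f : Fin (Fintype.card X) ≃o X := monoEquivOfFin X rfl
  exact ⟨f.symm.toEquiv, fun x y => (f.symm.le_iff_le (x := x) (y := y)).symm⟩

/-- The successive pairs of the enumeration `e` that the relation `W` reverses. -/
def cutSet {X : Type*} {n : ℕ} (e : X ≃ Fin n) (W : Set (X × X)) : Set (Fin (n - 1)) :=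
  {k | (e.symm ⟨k + 1, by omega⟩, e.symm ⟨k, by omega⟩) ∈ W}

/-- The relation obtained from the enumeration `e` by merging the successive pairs in `S`. -/
def mergeOrder {X : Type*} {n : ℕ} (e : X ≃ Fin n) (S : Set (Fin (n - 1))) : Set (X × X) :=
  {p | ∀ k : Fin (n - 1), (e p.2 : ℕ) ≤ k → (k : ℕ) < e p.1 → k ∈ S}

theorem isWeakOrder_mergeOrder {X : Type*} {n : ℕ} (e : X ≃ Fin n) (S : Set (Fin (n - 1))) :
    IsWeakOrder (mergeOrder e S) := by
  refine ⟨fun x y z hxy hyz k hz hx => ?_, fun x y => ?_⟩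
  · rcases lt_or_ge (k : ℕ) (e y) with h | h
    · exact hyz k hz h
    · exact hxy k h hx
  · rcases le_total (e x : ℕ) (e y) with h | h
    · exact Or.inl fun k (h₁ : (e y : ℕ) ≤ k) (h₂ : (k : ℕ) < e x) => by omega
    · exact Or.inr fun k (h₁ : (e x : ℕ) ≤ k) (h₂ : (k : ℕ) < e y) => by omega

theorem subset_mergeOrder {X : Type*} {n : ℕ} (e : X ≃ Fin n) {L : Set (X × X)}
    (he : ∀ x y, (x, y) ∈ L ↔ e x ≤ e y) (S : Set (Fin (n - 1))) : L ⊆ mergeOrder e S := by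
  rintro ⟨x, y⟩ hxy k (h₁ : (e y : ℕ) ≤ k) (h₂ : (k : ℕ) < e x)
  have h : (e x : ℕ) ≤ e y := (he x y).1 hxy
  omega

theorem cutSet_mergeOrder {X : Type*} {n : ℕ} (e : X ≃ Fin n) (S : Set (Fin (n - 1))) :
    cutSet e (mergeOrder e S) = S := by
  ext k
  simp only [cutSet, mergeOrder, Set.mem_ofPred_eq, Equiv.apply_symm_apply]
  refine ⟨fun h => h k le_rfl (Nat.lt_succ_self _), fun hk j h₁ h₂ => ?_⟩
  obtain rfl : j = k := Fin.ext (by omega)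
  exact hk

theorem mergeOrder_cutSet {X : Type*} {n : ℕ} (e : X ≃ Fin n) {L W : Set (X × X)}
    (he : ∀ x y, (x, y) ∈ L ↔ e x ≤ e y) (hW : IsWeakOrder W) (hLW : L ⊆ W) :
    mergeOrder e (cutSet e W) = W := by
  have of_le {x y : X} (h : (e x : ℕ) ≤ e y) : (x, y) ∈ W := hLW ((he x y).2 h)
  ext ⟨x, y⟩
  constructor
  · intro h
    have chain : ∀ m, (e y : ℕ) ≤ m → ∀ hm : m < n, m ≤ e x → (e.symm ⟨m, hm⟩, y) ∈ W := by
      intro m hm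
      induction m, hm using Nat.le_induction with
      | base => intro hm _; exact of_le (by simp)
      | succ m hm ih =>
        intro hmn hmx
        exact hW.1 _ _ _ (h ⟨m, by omega⟩ hm hmx) (ih (by omega) (by omega))
    rcases le_total (e x : ℕ) (e y) with hxy | hxy
    · exact of_le hxy
    · simpa using chain (e x) hxy (e x).2 le_rfl
  · intro h k (h₁ : (e y : ℕ) ≤ k) (h₂ : (k : ℕ) < e x)
    exact hW.1 _ _ _ (of_le (by simpa using h₂)) (hW.1 _ _ _ h (of_le (by simpa using h₁)))

/-- for a linear order `L` on an `n`-element set (`n ≥ 2`), the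
poset of weak orders containing `L` (ordered by inclusion) is order-isomorphic
to the Boolean lattice of all subsets of an `(n-1)`-element set. -/
theorem interval_above_linear_order_is_cube {X : Type*} [Fintype X]
    (hn : 2 ≤ Fintype.card X)
    (L : Set (X × X)) (hL : IsWeakOrder L)
    (hanti : ∀ x y : X, (x, y) ∈ L → (y, x) ∈ L → x = y) :
    Nonempty ({W : Set (X × X) // IsWeakOrder W ∧ L ⊆ W} ≃o
      Set (Fin (Fintype.card X - 1))) := by
  obtain ⟨e, he⟩ := hL.exists_equiv_fin hanti
  refine ⟨{ toFun := fun W => cutSet e W.1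
            invFun := fun S =>
              ⟨mergeOrder e S, isWeakOrder_mergeOrder e S, subset_mergeOrder e he S⟩
            left_inv := fun W => Subtype.ext (mergeOrder_cutSet e he W.2.1 W.2.2)
            right_inv := cutSet_mergeOrder e
            map_rel_iff' := ?_ }⟩
  rintro ⟨V, hV, hLV⟩ ⟨W, hW, hLW⟩
  refine ⟨fun h => ?_, fun h k hk => h hk⟩
  change V ⊆ W
  rw [← mergeOrder_cutSet e he hV hLV, ← mergeOrder_cutSet e he hW hLW]
  exact fun p hp k h₁ h₂ => h (hp k h₁ h₂)
end

section
/- Let X be a finite set and let W be a binary relation on X. Then W is a weak order on X if and only if there exists a function f : X → ℝ such that for all x, y ∈ X, (x,y) ∈ W ⇔ f(x) ≤ f(y). -/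
/-- a binary relation on a finite set is a weak order iff it has
a numerical representation `(x,y) ∈ W ↔ f x ≤ f y`. -/
theorem weak_order_iff_numerical_representation {X : Type*} [Fintype X]
    (W : Set (X × X)) :
    IsWeakOrder W ↔ ∃ f : X → ℝ, ∀ x y : X, (x, y) ∈ W ↔ f x ≤ f y := by
  constructor
  · rintro ⟨htrans, htotal⟩
    refine ⟨fun x => ({z | (z, x) ∈ W}.ncard : ℝ), fun x y => ?_⟩
    rw [Nat.cast_le]
    refine ⟨fun hxy => Set.ncard_le_ncard (fun z hz => htrans z x y hz hxy) (Set.toFinite _),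
      fun hle => ?_⟩
    have hyx : (y, x) ∈ W → (x, y) ∈ W := fun hyx => by
      have hsub : {z | (z, y) ∈ W} ⊆ {z | (z, x) ∈ W} := fun z hz => htrans z y x hz hyx
      have heq := Set.eq_of_subset_of_ncard_le hsub hle (Set.toFinite _)
      have hx : x ∈ {z | (z, x) ∈ W} := or_self_iff.mp (htotal x x)
      rwa [← heq] at hx
    exact (htotal x y).elim id hyx
  · rintro ⟨f, hf⟩
    simp only [IsWeakOrder, hf]
    exact ⟨fun _ _ _ => le_trans, fun x y => le_total (f x) (f y)⟩
end

section
/- Let X be a finite set, let W be a weak order on X and let V be a weak 2-order on X such that W is not contained in V (i.e., V ∉ J_W) and W ∩ V is a weak order. Then W covers W ∩ V in the inclusion order on weak orders: W ∩ V ⊊ W and no weak order lies strictly between W ∩ V and W. Moreover J_{W ∩ V} = J_W ∪ {V}. -/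
/-- A weak 2-order is determined by its upper indifference class. -/
theorem IsWeak2Order.exists_upper_class {X : Type*} {V : Set (X × X)} (hV : IsWeak2Order V) :
    ∃ A : Set X, ∀ x y, (x, y) ∈ V ↔ (y ∈ A → x ∈ A) := by
  obtain ⟨⟨htrans, htotal⟩, hcard⟩ := hV
  obtain ⟨S, T, hST, hclasses⟩ := Set.ncard_eq_two.mp hcard
  obtain ⟨s, rfl⟩ : S ∈ IndiffClasses V := by simp [hclasses]
  obtain ⟨t, rfl⟩ : T ∈ IndiffClasses V := by simp [hclasses]
  have hcover (x : X) : ((x, s) ∈ V ∧ (s, x) ∈ V) ∨ ((x, t) ∈ V ∧ (t, x) ∈ V) := by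
    have hx : {y | (x, y) ∈ V ∧ (y, x) ∈ V} ∈ IndiffClasses V := ⟨x, rfl⟩
    have hxx : (x, x) ∈ V := (htotal x x).elim id id
    rw [hclasses] at hx
    rcases hx with hx | hx
    · have : x ∈ {y | (s, y) ∈ V ∧ (y, s) ∈ V} := hx ▸ ⟨hxx, hxx⟩
      exact Or.inl this.symm
    · have : x ∈ {y | (t, y) ∈ V ∧ (y, t) ∈ V} := hx ▸ ⟨hxx, hxx⟩
      exact Or.inr this.symm
  have hst : ¬((s, t) ∈ V ∧ (t, s) ∈ V) := by
    rintro ⟨h₁, h₂⟩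
    refine hST (Set.ext fun y => ⟨?_, ?_⟩)
    · exact fun h => ⟨htrans _ _ _ h₂ h.1, htrans _ _ _ h.2 h₁⟩
    · exact fun h => ⟨htrans _ _ _ h₁ h.1, htrans _ _ _ h.2 h₂⟩
  rcases htotal s t with h | h
  · refine ⟨{x | (x, s) ∈ V}, fun x y => ⟨fun hxy hy => htrans _ _ _ hxy hy, fun hxy => ?_⟩⟩
    simp only [Set.mem_ofPred_eq] at hxy
    grind
  · refine ⟨{x | (x, t) ∈ V}, fun x y => ⟨fun hxy hy => htrans _ _ _ hxy hy, fun hxy => ?_⟩⟩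
    simp only [Set.mem_ofPred_eq] at hxy
    grind

/-- if `W` is a weak order, `V` a weak 2-order not containing
`W`, and `W ∩ V` is a weak order, then `W` covers `W ∩ V` and
`J_{W ∩ V} = J_W ∪ {V}`. -/
theorem inter_weak2order_is_covered {X : Type*} [Fintype X]
    (W V : Set (X × X)) (hW : IsWeakOrder W) (hV : IsWeak2Order V)
    (hns : ¬W ⊆ V) (hWV : IsWeakOrder (W ∩ V)) :
    W ∩ V ⊂ W ∧
    (¬∃ W'' : Set (X × X), IsWeakOrder W'' ∧ W ∩ V ⊂ W'' ∧ W'' ⊂ W) ∧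
    JW (W ∩ V) = JW W ∪ {V} := by
  obtain ⟨A, hA⟩ := hV.exists_upper_class
  obtain ⟨htrans, -⟩ := hW
  have habove (z x : X) (hz : z ∈ A) (hx : x ∉ A) : (z, x) ∈ W := by
    rcases hWV.2 z x with h | h
    · exact h.1
    · exact absurd ((hA x z).1 h.2 hz) hx
  have hsplit (u v : X) (huv : (u, v) ∈ W) (hn : (u, v) ∉ W ∩ V) : u ∉ A ∧ v ∈ A := by
    have : ¬(v ∈ A → u ∈ A) := fun h => hn ⟨huv, (hA u v).2 h⟩
    tauto
  refine ⟨⟨Set.inter_subset_left, fun h => hns fun p hp => (h hp).2⟩, ?_, ?_⟩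
  · rintro ⟨U, hU, ⟨hWVU, hUWV⟩, hUW, hWU⟩
    obtain ⟨⟨x, y⟩, hxyU, hxy⟩ := Set.not_subset.mp hUWV
    obtain ⟨⟨u, v⟩, huvW, huv⟩ := Set.not_subset.mp hWU
    obtain ⟨hx, hy⟩ := hsplit x y (hUW hxyU) hxy
    obtain ⟨hu, hv⟩ := hsplit u v huvW fun h => huv (hWVU h)
    have hux : (u, x) ∈ U :=
      hWVU ⟨htrans _ _ _ huvW (habove v x hv hx), (hA u x).2 fun h => absurd h hx⟩
    have hyv : (y, v) ∈ U :=
      hWVU ⟨htrans _ _ _ (habove y u hy hu) huvW, (hA y v).2 fun _ => hy⟩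
    exact huv (hU.1 _ _ _ hux (hU.1 _ _ _ hxyU hyv))
  · refine Set.Subset.antisymm ?_ ?_
    · rintro U ⟨hU, hWVU⟩
      by_cases hWU : W ⊆ U
      · exact Or.inl ⟨hU, hWU⟩
      right
      obtain ⟨B, hB⟩ := hU.exists_upper_class
      obtain ⟨⟨u, v⟩, huvW, huv⟩ := Set.not_subset.mp hWU
      obtain ⟨hu, hv⟩ := hsplit u v huvW fun h => huv (hWVU h)
      obtain ⟨hvB, huB⟩ : v ∈ B ∧ u ∉ B := by
        rw [hB] at huv
        tauto
      have hAB : A = B := by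
        ext z
        by_cases hz : z ∈ A
        · have hzv : (z, v) ∈ U :=
            hWVU ⟨htrans _ _ _ (habove z u hz hu) huvW, (hA z v).2 fun _ => hz⟩
          exact iff_of_true hz ((hB z v).1 hzv hvB)
        · have huz : (u, z) ∈ U :=
            hWVU ⟨htrans _ _ _ huvW (habove v z hv hz), (hA u z).2 fun h => absurd h hz⟩
          exact iff_of_false hz fun h => huB ((hB u z).1 huz h)
      subst hAB
      exact Set.ext fun ⟨x, y⟩ => (hB x y).trans (hA x y).symm
    · rintro U (⟨hU, hWU⟩ | rfl)
      · exact ⟨hU, Set.inter_subset_left.trans hWU⟩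
      · exact ⟨hV, Set.inter_subset_right⟩
end
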